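/- Let n ≥ 1, V₀ ≥ 0, f := (V₀+1)/(2V₀+1), and let ν, w ∈ ℝⁿ with ‖ν‖ = 1, ⟨w, ν⟩ = 0 and w ≠ 0; set a := ‖w‖. Define A(ξ) ∈ End(ℝⁿ) for ξ ≠ 0 by A(ξ)v := ‖ξ‖⁻²·v − f·‖ξ‖⁻⁴·⟨v, ξ⟩·ξ. Then the End(ℝⁿ)-valued function t ↦ A(w + t·ν) is Bochner integrable on ℝ, and (2π)⁻¹ ∫_ℝ A(w + t·ν) dt = (1/(4a)) · ( 2·id − f·(ν ⊗ ν♭) − (f/a²)·(w ⊗ w♭) ). Moreover, this endomorphism is symmetric and positive definite; in particular it is bijective. (This is the principal symbol at the cotangent vector w of the boundary single layer operator S of the generalized Stokes operator, and its ellipticity.) -/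

import Mathlib

open MeasureTheory

noncomputable section

/-- The pairing `v ↦ ⟨v, ζ⟩ = Σ_j v_j ζ_j`, as an `ℝ`-linear functional on `ℝⁿ`. -/
def pairLR {n : ℕ} (ζ : Fin n → ℝ) : (Fin n → ℝ) →ₗ[ℝ] ℝ where
  toFun v := ∑ j, v j * ζ j
  map_add' v w := by simp [add_mul, Finset.sum_add_distrib]
  map_smul' c v := by simp [Finset.mul_sum, mul_assoc]

/-- The rank-one endomorphism `u ⊗ ζ♭` of `ℝⁿ` given by `v ↦ ⟨v, ζ⟩·u`. -/
def rankOneR {n : ℕ} (u ζ : Fin n → ℝ) : (Fin n → ℝ) →L[ℝ] (Fin n → ℝ) :=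
  LinearMap.toContinuousLinearMap ((pairLR ζ).smulRight u)

/-- The order `−2` principal symbol of the velocity block `𝒜` of the inverse of the
generalized Stokes operator: `A(ξ)v = ‖ξ‖⁻²·v − f·‖ξ‖⁻⁴·⟨v,ξ⟩·ξ`, with
`f = (V₀+1)/(2V₀+1)`. -/
def AsymbR {n : ℕ} (f : ℝ) (ξ : Fin n → ℝ) : (Fin n → ℝ) →L[ℝ] (Fin n → ℝ) :=
  ((∑ j, ξ j ^ 2)⁻¹) • ContinuousLinearMap.id ℝ (Fin n → ℝ) -
    (f * ((∑ j, ξ j ^ 2) ^ 2)⁻¹) • rankOneR ξ ξ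

/-- The endomorphism `(1/(4a))(2·id − f·(ν⊗ν♭) − (f/a²)·(w⊗w♭))` of `ℝⁿ` (the claimed value
of the principal symbol of the boundary single layer operator `S` at `w`, `a = ‖w‖`). -/
def SsymbR {n : ℕ} (f a : ℝ) (ν w : Fin n → ℝ) : (Fin n → ℝ) →L[ℝ] (Fin n → ℝ) :=
  (1 / (4 * a)) •
    ((2 : ℝ) • ContinuousLinearMap.id ℝ (Fin n → ℝ) -
      f • rankOneR ν ν - (f / a ^ 2) • rankOneR w w)

end

section ScalarIntegrals

variable {a : ℝ}

lemma integrable_inv_sq_add_sq (ha : 0 < a) :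
    Integrable fun t : ℝ => (a ^ 2 + t ^ 2)⁻¹ := by
  have h := (integrable_inv_one_add_sq.comp_div ha.ne').const_mul (a ^ 2)⁻¹
  refine h.congr (Filter.Eventually.of_forall fun t => ?_)
  have := ha.ne'
  have h1 : a ^ 2 + t ^ 2 ≠ 0 := by positivity
  have h2 : 1 + (t / a) ^ 2 ≠ 0 := by positivity
  field_simp

lemma integral_univ_inv_sq_add_sq (ha : 0 < a) :
    ∫ t : ℝ, (a ^ 2 + t ^ 2)⁻¹ = Real.pi / a := by
  have h := Measure.integral_comp_div (fun x : ℝ => (1 + x ^ 2)⁻¹) a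
  have h' : (fun t : ℝ => (a ^ 2 + t ^ 2)⁻¹) =
      fun t : ℝ => (a ^ 2)⁻¹ * (1 + (t / a) ^ 2)⁻¹ := by
    funext t
    have h1 : a ^ 2 + t ^ 2 ≠ 0 := by positivity
    have h2 : 1 + (t / a) ^ 2 ≠ 0 := by positivity
    field_simp
  rw [h', integral_const_mul, h, integral_univ_inv_one_add_sq, abs_of_pos ha, smul_eq_mul]
  field_simp

lemma integrable_inv_sq_add_sq_sq (ha : 0 < a) :
    Integrable fun t : ℝ => ((a ^ 2 + t ^ 2) ^ 2)⁻¹ := by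
  refine ((integrable_inv_sq_add_sq ha).const_mul (a ^ 2)⁻¹).mono'
    (by fun_prop) (Filter.Eventually.of_forall fun t => ?_)
  rw [Real.norm_of_nonneg (by positivity), sq (a ^ 2 + t ^ 2), mul_inv]
  gcongr
  nlinarith [sq_nonneg t]

lemma integrable_mul_inv_sq_add_sq_sq (ha : 0 < a) :
    Integrable fun t : ℝ => t * ((a ^ 2 + t ^ 2) ^ 2)⁻¹ := by
  refine ((integrable_inv_sq_add_sq ha).const_mul a⁻¹).mono'
    (by fun_prop) (Filter.Eventually.of_forall fun t => ?_)
  rw [norm_mul, Real.norm_of_nonneg (r := ((a ^ 2 + t ^ 2) ^ 2)⁻¹) (by positivity),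
    sq (a ^ 2 + t ^ 2), mul_inv, ← mul_assoc]
  gcongr
  rw [← div_eq_mul_inv, div_le_iff₀ (by positivity), inv_mul_eq_div, le_div_iff₀ ha,
    Real.norm_eq_abs]
  nlinarith [sq_nonneg (|t| - a), sq_abs t, sq_nonneg (|t| + a)]

lemma integrable_sq_mul_inv_sq_add_sq_sq (ha : 0 < a) :
    Integrable fun t : ℝ => t ^ 2 * ((a ^ 2 + t ^ 2) ^ 2)⁻¹ := by
  refine (integrable_inv_sq_add_sq ha).mono' (by fun_prop)
    (Filter.Eventually.of_forall fun t => ?_)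
  rw [Real.norm_of_nonneg (by positivity), ← div_eq_mul_inv, div_le_iff₀ (by positivity),
    sq (a ^ 2 + t ^ 2), inv_mul_cancel_left₀ (by positivity)]
  nlinarith [sq_nonneg a]

lemma integral_mul_inv_sq_add_sq_sq :
    ∫ t : ℝ, t * ((a ^ 2 + t ^ 2) ^ 2)⁻¹ = 0 := by
  have h := integral_neg_eq_self (fun t : ℝ => t * ((a ^ 2 + t ^ 2) ^ 2)⁻¹) volume
  simp only [neg_sq, neg_mul, integral_neg] at h
  linarith

lemma tendsto_div_sq_add_sq_cocompact (ha : 0 < a) :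
    Filter.Tendsto (fun t : ℝ => t / (a ^ 2 + t ^ 2)) (Filter.cocompact ℝ) (nhds 0) := by
  have hinv : Filter.Tendsto (fun t : ℝ => ‖t‖⁻¹) (Filter.cocompact ℝ) (nhds 0) :=
    tendsto_inv_atTop_zero.comp (tendsto_norm_cocompact_atTop (E := ℝ))
  refine squeeze_zero_norm (fun t => ?_) hinv
  rcases eq_or_ne t 0 with rfl | ht
  · simp
  have ht' : 0 < |t| := abs_pos.mpr ht
  rw [norm_div, Real.norm_eq_abs, Real.norm_of_nonneg (by positivity), inv_eq_one_div,
    div_le_div_iff₀ (by positivity) ht']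
  nlinarith [sq_abs t, sq_nonneg a]

lemma integral_sq_mul_inv_sq_add_sq_sq_eq (ha : 0 < a) :
    ∫ t : ℝ, t ^ 2 * ((a ^ 2 + t ^ 2) ^ 2)⁻¹ = a ^ 2 * ∫ t : ℝ, ((a ^ 2 + t ^ 2) ^ 2)⁻¹ := by
  have hd : ∀ t : ℝ, HasDerivAt (fun t : ℝ => t / (a ^ 2 + t ^ 2))
      (a ^ 2 * ((a ^ 2 + t ^ 2) ^ 2)⁻¹ - t ^ 2 * ((a ^ 2 + t ^ 2) ^ 2)⁻¹) t := by
    intro t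
    have h0 : a ^ 2 + t ^ 2 ≠ 0 := by positivity
    refine ((hasDerivAt_id' t).fun_div ((hasDerivAt_pow 2 t).const_add (a ^ 2)) h0).congr_deriv ?_
    field_simp
    push_cast
    ring
  have hi := (integrable_inv_sq_add_sq_sq ha).const_mul (a ^ 2)
  have hlim := tendsto_div_sq_add_sq_cocompact ha
  have h := integral_of_hasDerivAt_of_tendsto hd (hi.sub (integrable_sq_mul_inv_sq_add_sq_sq ha))
    (hlim.mono_left atBot_le_cocompact) (hlim.mono_left atTop_le_cocompact)
  rw [integral_sub hi (integrable_sq_mul_inv_sq_add_sq_sq ha), integral_const_mul] at h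
  linarith

lemma integral_sq_mul_inv_sq_add_sq_sq (ha : 0 < a) :
    ∫ t : ℝ, t ^ 2 * ((a ^ 2 + t ^ 2) ^ 2)⁻¹ = Real.pi / (2 * a) := by
  have h : ∫ t : ℝ, (a ^ 2 + t ^ 2)⁻¹ =
      ∫ t : ℝ, (a ^ 2 * ((a ^ 2 + t ^ 2) ^ 2)⁻¹ + t ^ 2 * ((a ^ 2 + t ^ 2) ^ 2)⁻¹) := by
    congr 1
    funext t
    have h0 : a ^ 2 + t ^ 2 ≠ 0 := by positivity
    field_simp
  rw [integral_add ((integrable_inv_sq_add_sq_sq ha).const_mul _)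
    (integrable_sq_mul_inv_sq_add_sq_sq ha), integral_const_mul,
    ← integral_sq_mul_inv_sq_add_sq_sq_eq ha, integral_univ_inv_sq_add_sq ha] at h
  rw [mul_comm, ← div_div, h]
  ring

lemma integral_inv_sq_add_sq_sq (ha : 0 < a) :
    ∫ t : ℝ, ((a ^ 2 + t ^ 2) ^ 2)⁻¹ = Real.pi / (2 * a ^ 3) := by
  have h := integral_sq_mul_inv_sq_add_sq_sq_eq ha
  rw [integral_sq_mul_inv_sq_add_sq_sq ha] at h
  field_simp at h ⊢
  linarith

end ScalarIntegrals

section Symbols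

variable {n : ℕ}

lemma rankOneR_apply (u ζ v : Fin n → ℝ) : rankOneR u ζ v = (v ⬝ᵥ ζ) • u := rfl

lemma sum_sq_eq_dotProduct (v : Fin n → ℝ) : ∑ j, v j ^ 2 = v ⬝ᵥ v := by
  simp only [dotProduct, sq]

lemma AsymbR_add_smul (f a t : ℝ) {ν w : Fin n → ℝ} (hν : ν ⬝ᵥ ν = 1) (hw : w ⬝ᵥ ν = 0)
    (ha : a ^ 2 = w ⬝ᵥ w) :
    AsymbR f (w + t • ν) =
      (a ^ 2 + t ^ 2)⁻¹ • ContinuousLinearMap.id ℝ (Fin n → ℝ) -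
        f • (((a ^ 2 + t ^ 2) ^ 2)⁻¹ • rankOneR w w +
          (t * ((a ^ 2 + t ^ 2) ^ 2)⁻¹) • (rankOneR w ν + rankOneR ν w) +
          (t ^ 2 * ((a ^ 2 + t ^ 2) ^ 2)⁻¹) • rankOneR ν ν) := by
  have hsq : ∑ j, (w + t • ν) j ^ 2 = a ^ 2 + t ^ 2 := by
    rw [sum_sq_eq_dotProduct]
    simp only [dotProduct_add, add_dotProduct, smul_dotProduct, dotProduct_smul, smul_eq_mul,
      dotProduct_comm ν w, hν, hw, ha]
    ring
  rw [AsymbR, hsq]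
  ext1 v
  funext i
  simp only [sub_apply, add_apply,
    smul_apply, rankOneR_apply, Pi.add_apply, Pi.sub_apply, Pi.smul_apply,
    smul_eq_mul, dotProduct_add, dotProduct_smul]
  ring

lemma SsymbR_dotProduct (f a : ℝ) (ν w v u : Fin n → ℝ) :
    SsymbR f a ν w v ⬝ᵥ u = 1 / (4 * a) *
      (2 * (v ⬝ᵥ u) - f * ((v ⬝ᵥ ν) * (ν ⬝ᵥ u)) - f / a ^ 2 * ((v ⬝ᵥ w) * (w ⬝ᵥ u))) := by
  simp only [SsymbR, sub_apply, smul_apply,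
    rankOneR_apply, ContinuousLinearMap.id_apply, smul_dotProduct, sub_dotProduct, smul_eq_mul]

lemma SsymbR_dotProduct_comm (f a : ℝ) (ν w v u : Fin n → ℝ) :
    SsymbR f a ν w v ⬝ᵥ u = v ⬝ᵥ SsymbR f a ν w u := by
  rw [dotProduct_comm v, SsymbR_dotProduct, SsymbR_dotProduct, dotProduct_comm u v,
    dotProduct_comm u ν, dotProduct_comm u w, dotProduct_comm v ν, dotProduct_comm v w]
  ring

lemma bessel_dotProduct_pair {a : ℝ} {ν w : Fin n → ℝ} (ha : 0 < a) (hν : ν ⬝ᵥ ν = 1)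
    (hw : w ⬝ᵥ ν = 0) (haw : a ^ 2 = w ⬝ᵥ w) (v : Fin n → ℝ) :
    (v ⬝ᵥ ν) ^ 2 + (v ⬝ᵥ w) ^ 2 / a ^ 2 ≤ v ⬝ᵥ v := by
  have h : 0 ≤ (v - (v ⬝ᵥ ν) • ν - (v ⬝ᵥ w / a ^ 2) • w) ⬝ᵥ
      (v - (v ⬝ᵥ ν) • ν - (v ⬝ᵥ w / a ^ 2) • w) :=
    Finset.sum_nonneg fun i _ => mul_self_nonneg _
  simp only [dotProduct_sub, sub_dotProduct, smul_dotProduct, dotProduct_smul, smul_eq_mul,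
    dotProduct_comm ν w, dotProduct_comm ν v, dotProduct_comm w v, hν, hw, ← haw] at h
  have h' : v ⬝ᵥ w / a ^ 2 * a ^ 2 = v ⬝ᵥ w := by field_simp
  rw [h'] at h
  have h'' : v ⬝ᵥ w / a ^ 2 * (v ⬝ᵥ w) = (v ⬝ᵥ w) ^ 2 / a ^ 2 := by ring
  nlinarith

lemma SsymbR_dotProduct_self_pos {f a : ℝ} {ν w : Fin n → ℝ} (hf0 : 0 ≤ f) (hf2 : f < 2)
    (ha : 0 < a) (hν : ν ⬝ᵥ ν = 1) (hw : w ⬝ᵥ ν = 0) (haw : a ^ 2 = w ⬝ᵥ w)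
    {v : Fin n → ℝ} (hv : v ≠ 0) : 0 < SsymbR f a ν w v ⬝ᵥ v := by
  rw [SsymbR_dotProduct, dotProduct_comm ν, dotProduct_comm w]
  have hvv : 0 < v ⬝ᵥ v :=
    (Finset.sum_nonneg fun i _ => mul_self_nonneg (v i)).lt_of_ne'
      (mt dotProduct_self_eq_zero.mp hv)
  have hb := mul_le_mul_of_nonneg_left (bessel_dotProduct_pair ha hν hw haw v) hf0
  have hlt : f * (v ⬝ᵥ v) < 2 * (v ⬝ᵥ v) := mul_lt_mul_of_pos_right hf2 hvv
  refine mul_pos (by positivity) ?_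
  have h : f / a ^ 2 * (v ⬝ᵥ w * v ⬝ᵥ w) = f * ((v ⬝ᵥ w) ^ 2 / a ^ 2) := by ring
  rw [h]
  linarith

lemma integrable_AsymbR_add_smul (f : ℝ) {a : ℝ} {ν w : Fin n → ℝ} (ha : 0 < a)
    (hν : ν ⬝ᵥ ν = 1) (hw : w ⬝ᵥ ν = 0) (haw : a ^ 2 = w ⬝ᵥ w) :
    Integrable fun t : ℝ => AsymbR f (w + t • ν) := by
  simp only [AsymbR_add_smul f a _ hν hw haw]
  exact ((integrable_inv_sq_add_sq ha).smul_const _).sub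
    (((((integrable_inv_sq_add_sq_sq ha).smul_const _).add
      ((integrable_mul_inv_sq_add_sq_sq ha).smul_const _)).add
      ((integrable_sq_mul_inv_sq_add_sq_sq ha).smul_const _)).smul f)

lemma integral_AsymbR_add_smul (f : ℝ) {a : ℝ} {ν w : Fin n → ℝ} (ha : 0 < a)
    (hν : ν ⬝ᵥ ν = 1) (hw : w ⬝ᵥ ν = 0) (haw : a ^ 2 = w ⬝ᵥ w) :
    (2 * Real.pi)⁻¹ • ∫ t : ℝ, AsymbR f (w + t • ν) = SsymbR f a ν w := by
  simp only [AsymbR_add_smul f a _ hν hw haw]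
  have h0 := (integrable_inv_sq_add_sq ha).smul_const (ContinuousLinearMap.id ℝ (Fin n → ℝ))
  have h1 := (integrable_inv_sq_add_sq_sq ha).smul_const (rankOneR w w)
  have h2 := (integrable_mul_inv_sq_add_sq_sq ha).smul_const (rankOneR w ν + rankOneR ν w)
  have h3 := (integrable_sq_mul_inv_sq_add_sq_sq ha).smul_const (rankOneR ν ν)
  have h12 := h1.add h2
  have h123 := h12.add h3
  have hf := h123.smul f
  simp only [Pi.add_def, Pi.smul_def] at h12 h123 hf
  rw [integral_sub h0 hf, integral_smul, integral_add h12 h3, integral_add h1 h2]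
  simp only [integral_smul_const]
  simp only [integral_univ_inv_sq_add_sq ha, integral_inv_sq_add_sq_sq ha,
    integral_mul_inv_sq_add_sq_sq, integral_sq_mul_inv_sq_add_sq_sq ha, zero_smul, add_zero,
    SsymbR, smul_sub, smul_add, smul_smul]
  have hπ := Real.pi_ne_zero
  have e0 : (2 * Real.pi)⁻¹ * (Real.pi / a) = 1 / (4 * a) * 2 := by field_simp; norm_num
  have e1 : (2 * Real.pi)⁻¹ * (f * (Real.pi / (2 * a ^ 3))) = 1 / (4 * a) * (f / a ^ 2) := by
    field_simp; ring
  have e3 : (2 * Real.pi)⁻¹ * (f * (Real.pi / (2 * a))) = 1 / (4 * a) * f := by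
    field_simp; ring
  rw [e0, e1, e3]
  abel

end Symbols

/-- For `V₀ ≥ 0`, `f = (V₀+1)/(2V₀+1)`, a unit normal `ν` and `0 ≠ w ⊥ ν` with `a = ‖w‖`:
`t ↦ A(w + t·ν)` is Bochner integrable on `ℝ` with values in `End(ℝⁿ)`, and
`(2π)⁻¹ ∫ A(w+tν) dt = (1/(4a))(2·id − f·(ν⊗ν♭) − (f/a²)·(w⊗w♭))`; moreover this
endomorphism is symmetric and positive definite, in particular bijective.  (This is the
principal symbol at `w` of the boundary single layer operator `S` of the generalized
Stokes operator, and its ellipticity.) -/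
theorem boundary_single_layer_principal_symbol (n : ℕ) (hn : 1 ≤ n)
    (V₀ : ℝ) (hV₀ : 0 ≤ V₀) (ν w : Fin n → ℝ)
    (hν : ∑ j, ν j ^ 2 = 1) (hw : ∑ j, w j * ν j = 0) (hw0 : w ≠ 0) :
    (Integrable fun t : ℝ => AsymbR ((V₀ + 1) / (2 * V₀ + 1)) (w + t • ν)) ∧
    (2 * Real.pi)⁻¹ • (∫ t : ℝ, AsymbR ((V₀ + 1) / (2 * V₀ + 1)) (w + t • ν)) =
      SsymbR ((V₀ + 1) / (2 * V₀ + 1)) (Real.sqrt (∑ j, w j ^ 2)) ν w ∧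
    (∀ v u : Fin n → ℝ,
      ∑ j, SsymbR ((V₀ + 1) / (2 * V₀ + 1)) (Real.sqrt (∑ j, w j ^ 2)) ν w v j * u j =
        ∑ j, v j * SsymbR ((V₀ + 1) / (2 * V₀ + 1)) (Real.sqrt (∑ j, w j ^ 2)) ν w u j) ∧
    (∀ v : Fin n → ℝ, v ≠ 0 →
      0 < ∑ j, SsymbR ((V₀ + 1) / (2 * V₀ + 1)) (Real.sqrt (∑ j, w j ^ 2)) ν w v j * v j) ∧
    Function.Bijective (fun v : Fin n → ℝ =>
      SsymbR ((V₀ + 1) / (2 * V₀ + 1)) (Real.sqrt (∑ j, w j ^ 2)) ν w v) := by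
  have hν' : ν ⬝ᵥ ν = 1 := by rw [← sum_sq_eq_dotProduct, hν]
  have hww : 0 < ∑ j, w j ^ 2 := by
    rw [sum_sq_eq_dotProduct]
    exact (Finset.sum_nonneg fun i _ => mul_self_nonneg (w i)).lt_of_ne'
      (mt dotProduct_self_eq_zero.mp hw0)
  have ha := Real.sqrt_pos.mpr hww
  have haw := (Real.sq_sqrt hww.le).trans (sum_sq_eq_dotProduct w)
  have hf0 : 0 ≤ (V₀ + 1) / (2 * V₀ + 1) := by positivity
  have hf2 : (V₀ + 1) / (2 * V₀ + 1) < 2 := by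
    rw [div_lt_iff₀ (by positivity)]
    linarith
  have hpos := fun v (hv : v ≠ 0) => SsymbR_dotProduct_self_pos hf0 hf2 ha hν' hw haw hv
  refine ⟨integrable_AsymbR_add_smul _ ha hν' hw haw, integral_AsymbR_add_smul _ ha hν' hw haw,
    SsymbR_dotProduct_comm _ _ ν w, hpos, ?_⟩
  set S := SsymbR ((V₀ + 1) / (2 * V₀ + 1)) (Real.sqrt (∑ j, w j ^ 2)) ν w
  have hinj : Function.Injective (S : (Fin n → ℝ) →ₗ[ℝ] (Fin n → ℝ)) := by
    refine (injective_iff_map_eq_zero _).mpr fun v hv => ?_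
    by_contra hne
    have h := hpos v hne
    rw [show S v = 0 from hv, zero_dotProduct] at h
    exact h.false
  exact ⟨hinj, LinearMap.injective_iff_surjective.mp hinj⟩
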